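/- arXiv:2005.14460 — 2 statements merged into one kernel-verified Lean document; each statement's English description precedes it below -/
import Mathlib

section
/- For h ∈ (0, 1/2], let R^h(t,s) = (1/2)(t^{2h} + s^{2h} − |t−s|^{2h}) be the covariance function of fractional Brownian motion with Hurst index h. Then there exists a constant c > 0 such that for all 0 ≤ u ≤ v ≤ T and 0 ≤ u' ≤ v' ≤ T, the rectangular increment satisfies |R^h(v,v') − R^h(u,v') − R^h(v,u') + R^h(u,u')| ≤ c |v−u|^h |v'−u'|^h. Consequently, for any bounded linear operator Q on a separable real Hilbert space H, the map (t,s) ↦ R^h(t,s)Q is an h-regular covariance operator. -/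
open Set

/-- The covariance function of fractional Brownian motion with Hurst index `h`. -/
noncomputable def fbmCov (h t s : ℝ) : ℝ :=
  (t ^ (2 * h) + s ^ (2 * h) - |t - s| ^ (2 * h)) / 2

theorem holder_aux (p x y : ℝ) (hp : 0 ≤ p) (hp1 : p ≤ 1) :
    |(|x| ^ p - |y| ^ p)| ≤ |x - y| ^ p := by
  have key : ∀ a b : ℝ, |a| ^ p ≤ |a - b| ^ p + |b| ^ p := by
    intro a b
    have h1 : |a| ≤ |a - b| + |b| := by
      have := abs_add_le (a - b) b
      simpa using this
    exact (Real.rpow_le_rpow (abs_nonneg _) h1 hp).trans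
      (Real.rpow_add_le_add_rpow (abs_nonneg _) (abs_nonneg _) hp hp1)
  have h1 := key x y
  have h2 := key y x
  rw [abs_sub_comm y x] at h2
  rw [abs_le]
  constructor <;> linarith

theorem geom_aux (h a b X : ℝ) (ha : 0 ≤ a) (hb : 0 ≤ b)
    (h1 : X ≤ a ^ (2 * h)) (h2 : X ≤ b ^ (2 * h)) : X ≤ a ^ h * b ^ h := by
  have e : ∀ z : ℝ, 0 ≤ z → z ^ (2 * h) = z ^ h * z ^ h := by
    intro z hz
    rw [mul_comm, Real.rpow_mul hz, Real.rpow_two, sq]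
  rw [e a ha] at h1
  rw [e b hb] at h2
  have pa := Real.rpow_nonneg ha h
  have pb := Real.rpow_nonneg hb h
  rcases le_total (a ^ h) (b ^ h) with hab | hab
  · exact h1.trans (mul_le_mul_of_nonneg_left hab pa)
  · exact h2.trans (mul_le_mul_of_nonneg_right hab pb)

theorem rect_aux (h u v u' v' : ℝ) (hh0 : 0 < h) (hh : h ≤ 1 / 2) (huv : u ≤ v)
    (huv' : u' ≤ v') :
    |fbmCov h v v' - fbmCov h u v' - fbmCov h v u' + fbmCov h u u'| ≤
      (v - u) ^ h * (v' - u') ^ h := by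
  have H := fun x y => holder_aux (2 * h) x y (by linarith) (by linarith)
  have A1 := H (u - v') (v - v')
  have A2 := H (v - u') (u - u')
  have B1 := H (u - v') (u - u')
  have B2 := H (v - u') (v - v')
  rw [show u - v' - (v - v') = -(v - u) by ring, abs_neg,
    abs_of_nonneg (sub_nonneg.2 huv)] at A1
  rw [show v - u' - (u - u') = (v - u) by ring, abs_of_nonneg (sub_nonneg.2 huv)] at A2
  rw [show u - v' - (u - u') = -(v' - u') by ring, abs_neg,
    abs_of_nonneg (sub_nonneg.2 huv')] at B1
  rw [show v - u' - (v - v') = (v' - u') by ring, abs_of_nonneg (sub_nonneg.2 huv')] at B2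
  rw [abs_le] at A1 A2 B1 B2
  apply geom_aux h _ _ _ (sub_nonneg.2 huv) (sub_nonneg.2 huv')
  · unfold fbmCov
    rw [abs_le]
    constructor <;> linarith [A1.1, A1.2, A2.1, A2.2]
  · unfold fbmCov
    rw [abs_le]
    constructor <;> linarith [B1.1, B1.2, B2.1, B2.2]

theorem fbmCov_symm (h t s : ℝ) : fbmCov h t s = fbmCov h s t := by
  unfold fbmCov
  rw [abs_sub_comm]
  ring

theorem one_aux (T h s t r : ℝ) (hh0 : 0 < h) (hh : h ≤ 1 / 2) (hs : 0 ≤ s) (hst : s ≤ t)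
    (htT : t ≤ T) : |fbmCov h t r - fbmCov h s r| ≤ T ^ h * (t - s) ^ h := by
  have H := fun x y => holder_aux (2 * h) x y (by linarith) (by linarith)
  have A1 := H t s
  have A2 := H (t - r) (s - r)
  rw [abs_of_nonneg (sub_nonneg.2 hst), abs_of_nonneg hs, abs_of_nonneg (hs.trans hst)] at A1
  rw [show t - r - (s - r) = t - s by ring, abs_of_nonneg (sub_nonneg.2 hst)] at A2
  rw [abs_le] at A1 A2
  have hle : (t - s) ^ (2 * h) ≤ T ^ (2 * h) :=
    Real.rpow_le_rpow (sub_nonneg.2 hst) (by linarith) (by linarith)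
  have hb : |fbmCov h t r - fbmCov h s r| ≤ (t - s) ^ (2 * h) := by
    unfold fbmCov
    rw [abs_le]
    constructor <;> linarith [A1.1, A1.2, A2.1, A2.2]
  exact geom_aux h _ _ _ (by linarith) (sub_nonneg.2 hst) (hb.trans hle) hb

/-- The rectangular increments of the fBm covariance `R^h` (with
`h ∈ (0, 1/2]`) are bounded by `c |v-u|^h |v'-u'|^h`; consequently, for every bounded
linear operator `Q` on a separable Hilbert space, `(t,s) ↦ R^h(t,s) Q` is an `h`-regular
covariance operator. -/
theorem fbm_covariance_h_regular
    {H : Type*} [NormedAddCommGroup H] [InnerProductSpace ℝ H] [CompleteSpace H]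
    [TopologicalSpace.SeparableSpace H]
    (T h : ℝ) (hT : 0 ≤ T) (hh0 : 0 < h) (hh : h ≤ 1 / 2) :
    ∃ c : ℝ, 0 < c ∧
      (∀ u v u' v', 0 ≤ u → u ≤ v → v ≤ T → 0 ≤ u' → u' ≤ v' → v' ≤ T →
        |fbmCov h v v' - fbmCov h u v' - fbmCov h v u' + fbmCov h u u'| ≤
          c * (v - u) ^ h * (v' - u') ^ h) ∧
      ∀ Q : H →L[ℝ] H, ∃ C : ℝ, 0 ≤ C ∧
        (∀ s t t', 0 ≤ s → s ≤ t → t ≤ T → t' ∈ Icc (0 : ℝ) T →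
          ‖fbmCov h t t' • Q - fbmCov h s t' • Q‖ ≤ C * (t - s) ^ h) ∧
        (∀ t s' t', 0 ≤ s' → s' ≤ t' → t' ≤ T → t ∈ Icc (0 : ℝ) T →
          ‖fbmCov h t t' • Q - fbmCov h t s' • Q‖ ≤ C * (t' - s') ^ h) ∧
        (∀ s t s' t', 0 ≤ s → s ≤ t → t ≤ T → 0 ≤ s' → s' ≤ t' → t' ≤ T →
          ‖fbmCov h t t' • Q - fbmCov h s t' • Q - fbmCov h t s' • Q + fbmCov h s s' • Q‖ ≤
            C * ((t - s) * (t' - s')) ^ h) := by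
  refine ⟨1, one_pos, ?_, ?_⟩
  · intro u v u' v' _ huv _ _ huv' _
    rw [one_mul]
    exact rect_aux h u v u' v' hh0 hh huv huv'
  · intro Q
    have hTh : 0 ≤ T ^ h := Real.rpow_nonneg hT h
    have one : ∀ s t r, 0 ≤ s → s ≤ t → t ≤ T →
        |fbmCov h t r - fbmCov h s r| * ‖Q‖ ≤ (1 + T ^ h) * ‖Q‖ * (t - s) ^ h := by
      intro s t r hs hst htT
      have h1 := one_aux T h s t r hh0 hh hs hst htT
      have h2 := Real.rpow_nonneg (sub_nonneg.2 hst) h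
      calc _ ≤ ((1 + T ^ h) * (t - s) ^ h) * ‖Q‖ := by
            apply mul_le_mul_of_nonneg_right _ (norm_nonneg Q)
            linarith
        _ = _ := by ring
    refine ⟨(1 + T ^ h) * ‖Q‖, by positivity, ?_, ?_, ?_⟩
    · intro s t t' hs hst htT _
      rw [← sub_smul, norm_smul, Real.norm_eq_abs]
      exact one s t t' hs hst htT
    · intro t s' t' hs hst htT _
      rw [← sub_smul, norm_smul, Real.norm_eq_abs, fbmCov_symm h t t', fbmCov_symm h t s']
      exact one s' t' t hs hst htT
    · intro s t s' t' _ hst _ _ hst' _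
      rw [← sub_smul, ← sub_smul, ← add_smul, norm_smul, Real.norm_eq_abs,
        Real.mul_rpow (sub_nonneg.2 hst) (sub_nonneg.2 hst')]
      have h1 := rect_aux h s t s' t' hh0 hh hst hst'
      have h2 := mul_nonneg (Real.rpow_nonneg (sub_nonneg.2 hst) h)
        (Real.rpow_nonneg (sub_nonneg.2 hst') h)
      calc _ ≤ ((1 + T ^ h) * ((t - s) ^ h * (t' - s') ^ h)) * ‖Q‖ := by
            apply mul_le_mul_of_nonneg_right _ (norm_nonneg Q)
            nlinarith [mul_nonneg hTh h2]
        _ = _ := by ring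
end

section
/- Let H be a separable real Hilbert space, α ∈ (0,1), A ∈ L(H), y, ỹ ∈ H and X : [0,T] → H continuous. Suppose Y, Ỹ : [0,T] → H are continuous and satisfy, for all t ∈ [0,T], Y(t) = y + A I^α(Y)(t) + X(t) and Ỹ(t) = ỹ + A I^α(Ỹ)(t) + X(t), where I^α(f)(t) = (1/Γ(α)) ∫₀ᵗ (t−s)^{α−1} f(s) ds is the Bochner fractional integral. Then ‖Y(t) − Ỹ(t)‖_H ≤ ‖y − ỹ‖_H · E_{α,1}(‖A‖_op Γ(α) t^α) for all t ∈ [0,T], where E_{α,1}(x) = Σ_{i≥0} x^i/Γ(iα+1). In particular, if y = ỹ then Y ≡ Ỹ, i.e. the fractional Ornstein–Uhlenbeck equation has at most one continuous solution for each initial condition. -/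
open Set MeasureTheory

/-- The Riemann–Liouville fractional integral of order `α` of an `H`-valued function,
`I^α(f)(t) = (1/Γ(α)) ∫₀ᵗ (t-s)^(α-1) f(s) ds`. -/
noncomputable def fracInt {H : Type*} [NormedAddCommGroup H] [NormedSpace ℝ H]
    (α : ℝ) (f : ℝ → H) (t : ℝ) : H :=
  if α = 0 then f t
  else (Real.Gamma α)⁻¹ • ∫ s in Set.Ioc (0 : ℝ) t, ((t - s) ^ (α - 1) : ℝ) • f s

open Filter Topology in
theorem ml_summable (α : ℝ) (hα : 0 < α) (x : ℝ) :
    Summable (fun i : ℕ => x ^ i / Real.Gamma ((i : ℝ) * α + 1)) := by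
  have key : ∀ i : ℕ, 1 ≤ i → Real.Gamma ((i : ℝ) * α + 1) * ((i : ℝ) * α) ^ α ≤
      Real.Gamma (((i + 1 : ℕ) : ℝ) * α + 1) := by
    intro i hi
    have hi0 : (0 : ℝ) < i := by exact_mod_cast hi
    have hp : 0 < (i : ℝ) * α := by positivity
    have h := Real.convexOn_log_Gamma.slope_mono_adjacent (x := (i : ℝ) * α)
      (y := (i : ℝ) * α + 1) (z := (i : ℝ) * α + 1 + α) hp
      (by simp only [mem_Ioi]; positivity) (by linarith) (by linarith)
    have hG := Real.Gamma_pos_of_pos hp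
    have hG1 : 0 < Real.Gamma ((i : ℝ) * α + 1) := Real.Gamma_pos_of_pos (by positivity)
    have hG2 : 0 < Real.Gamma ((i : ℝ) * α + 1 + α) := Real.Gamma_pos_of_pos (by positivity)
    simp only [Function.comp] at h
    have e1 : Real.log (Real.Gamma ((i : ℝ) * α + 1)) - Real.log (Real.Gamma ((i : ℝ) * α))
        = Real.log ((i : ℝ) * α) := by
      rw [Real.Gamma_add_one hp.ne', Real.log_mul hp.ne' hG.ne']; ring
    rw [e1, add_sub_cancel_left, div_one, add_sub_cancel_left, le_div_iff₀ hα] at h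
    have e2 : ((i + 1 : ℕ) : ℝ) * α + 1 = (i : ℝ) * α + 1 + α := by push_cast; ring
    rw [e2, ← Real.log_le_log_iff (by positivity) hG2, Real.log_mul hG1.ne' (by positivity),
      Real.log_rpow hp]
    linarith
  have hlim : Tendsto (fun i : ℕ => ((i : ℝ) * α) ^ α) atTop atTop :=
    (tendsto_rpow_atTop hα).comp (tendsto_natCast_atTop_atTop.atTop_mul_const hα)
  refine summable_of_ratio_norm_eventually_le (r := 1 / 2) (by norm_num) ?_
  filter_upwards [hlim.eventually_ge_atTop (2 * |x| + 1), eventually_ge_atTop 1] with i h1 h2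
  have hG1 : 0 < Real.Gamma ((i : ℝ) * α + 1) := Real.Gamma_pos_of_pos (by positivity)
  have hG2 : 0 < Real.Gamma (((i + 1 : ℕ) : ℝ) * α + 1) := Real.Gamma_pos_of_pos (by positivity)
  rw [norm_div, norm_div, norm_pow, norm_pow, Real.norm_eq_abs, Real.norm_eq_abs,
    Real.norm_eq_abs, abs_of_pos hG1, abs_of_pos hG2, mul_div_assoc', div_le_div_iff₀ hG2 hG1]
  have hk := key i h2
  have hx : 0 ≤ |x| ^ i := by positivity
  calc |x| ^ (i + 1) * Real.Gamma ((i : ℝ) * α + 1)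
      = 1 / 2 * |x| ^ i * (Real.Gamma ((i : ℝ) * α + 1) * (2 * |x|)) := by ring
    _ ≤ 1 / 2 * |x| ^ i * (Real.Gamma ((i : ℝ) * α + 1) * ((i : ℝ) * α) ^ α) := by
        gcongr; linarith
    _ ≤ _ := by gcongr

theorem one_le_Gamma (α : ℝ) (h0 : 0 < α) (h1 : α < 1) : 1 ≤ Real.Gamma α := by
  have h := Real.convexOn_Gamma.slope_mono_adjacent (x := α) (y := 1) (z := 2) h0
    (by simp) h1 (by norm_num)
  rw [Real.Gamma_one, Real.Gamma_two] at h
  norm_num at h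
  rw [div_le_iff₀ (by linarith)] at h
  linarith

theorem real_beta (α p t : ℝ) (hα : 0 < α) (hp : 0 ≤ p) (ht : 0 < t) :
    ∫ s in Ioc (0 : ℝ) t, (t - s) ^ (α - 1) * s ^ p =
      t ^ (p + α) * (Real.Gamma (p + 1) * Real.Gamma α / Real.Gamma (p + 1 + α)) := by
  have h := Complex.betaIntegral_scaled ((p + 1 : ℝ) : ℂ) (α : ℂ) ht
  rw [Complex.betaIntegral_eq_Gamma_mul_div _ _ (by simp; linarith) (by simpa)] at h
  rw [← intervalIntegral.integral_of_le ht.le]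
  apply Complex.ofReal_injective
  rw [← intervalIntegral.integral_ofReal]
  convert h using 1
  · apply intervalIntegral.integral_congr
    intro s hs
    rw [uIcc_of_le ht.le] at hs
    simp only
    rw [Complex.ofReal_mul, Complex.ofReal_cpow (by linarith [hs.2]), Complex.ofReal_cpow hs.1]
    push_cast
    rw [add_sub_cancel_right, mul_comm]
  · rw [← Complex.ofReal_add, Complex.Gamma_ofReal, Complex.Gamma_ofReal, Complex.Gamma_ofReal,
      Complex.ofReal_mul, Complex.ofReal_cpow ht.le]
    push_cast
    congr 2
    ring

theorem kernel_integrable {E : Type*} [NormedAddCommGroup E] [NormedSpace ℝ E]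
    (α t : ℝ) (hα : 0 < α) (ht : 0 ≤ t) (f : ℝ → E) (hf : ContinuousOn f (Icc 0 t)) :
    IntegrableOn (fun s => ((t - s) ^ (α - 1) : ℝ) • f s) (Ioc 0 t) := by
  have h1 : IntervalIntegrable (fun s : ℝ => s ^ (α - 1)) volume 0 t :=
    intervalIntegral.intervalIntegrable_rpow' (by linarith)
  have h2 := (h1.comp_sub_left t).symm
  simp only [sub_zero, sub_self] at h2
  rw [intervalIntegrable_iff_integrableOn_Icc_of_le ht] at h2
  exact (h2.smul_continuousOn hf isCompact_Icc).mono_set Ioc_subset_Icc_self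

theorem ml_step (α b t : ℝ) (hα : 0 < α) (ht : 0 ≤ t) (i : ℕ) :
    b / Real.Gamma α * ∫ s in Ioc (0 : ℝ) t, (t - s) ^ (α - 1) •
      ((b * s ^ α) ^ i / Real.Gamma ((i : ℝ) * α + 1)) =
    (b * t ^ α) ^ (i + 1) / Real.Gamma (((i + 1 : ℕ) : ℝ) * α + 1) := by
  rcases ht.eq_or_lt with rfl | ht
  · simp [Real.zero_rpow hα.ne']
  have hG := (Real.Gamma_pos_of_pos hα).ne'
  have hG1 : Real.Gamma ((i : ℝ) * α + 1) ≠ 0 := (Real.Gamma_pos_of_pos (by positivity)).ne'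
  have hG2 : Real.Gamma ((i : ℝ) * α + 1 + α) ≠ 0 := (Real.Gamma_pos_of_pos (by positivity)).ne'
  have e : ∫ s in Ioc (0 : ℝ) t, (t - s) ^ (α - 1) •
      ((b * s ^ α) ^ i / Real.Gamma ((i : ℝ) * α + 1)) =
      ∫ s in Ioc (0 : ℝ) t, (b ^ i / Real.Gamma ((i : ℝ) * α + 1)) *
        ((t - s) ^ (α - 1) * s ^ ((i : ℝ) * α)) := by
    refine setIntegral_congr_fun measurableSet_Ioc fun s hs => ?_
    have : s ^ ((i : ℝ) * α) = (s ^ α) ^ i := by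
      rw [mul_comm, Real.rpow_mul hs.1.le, Real.rpow_natCast]
    simp only [this, smul_eq_mul, mul_pow]
    ring
  rw [e, integral_const_mul, real_beta _ _ _ hα (by positivity) ht]
  have e2 : ((i + 1 : ℕ) : ℝ) * α + 1 = (i : ℝ) * α + 1 + α := by push_cast; ring
  have e3 : t ^ ((i : ℝ) * α + α) = (t ^ α) ^ (i + 1) := by
    rw [← Real.rpow_natCast, ← Real.rpow_mul ht.le]; congr 1; push_cast; ring
  rw [e2, e3, mul_pow]
  field_simp
  ring

open Filter Topology in
theorem frac_gronwall (T α b d M : ℝ) (hα : 0 < α) (hb : 0 ≤ b)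
    (u : ℝ → ℝ) (hu : ContinuousOn u (Icc 0 T)) (hM : ∀ t ∈ Icc (0 : ℝ) T, u t ≤ M)
    (h : ∀ t ∈ Icc (0 : ℝ) T,
      u t ≤ d + b / Real.Gamma α * ∫ s in Ioc (0 : ℝ) t, (t - s) ^ (α - 1) • u s)
    (t : ℝ) (ht : t ∈ Icc (0 : ℝ) T) :
    u t ≤ d * ∑' i : ℕ, (b * t ^ α) ^ i / Real.Gamma ((i : ℝ) * α + 1) := by
  have hG := Real.Gamma_pos_of_pos hα
  have P : ∀ n : ℕ, ∀ t ∈ Icc (0 : ℝ) T,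
      u t ≤ d * ∑ i ∈ Finset.range n, (b * t ^ α) ^ i / Real.Gamma ((i : ℝ) * α + 1)
        + M * ((b * t ^ α) ^ n / Real.Gamma ((n : ℝ) * α + 1)) := by
    intro n
    induction n with
    | zero => intro t ht; simpa using hM t ht
    | succ n ih =>
      intro t ht
      have hc : ∀ i : ℕ, Continuous
          (fun s : ℝ => (b * s ^ α) ^ i / Real.Gamma ((i : ℝ) * α + 1)) := fun i =>
        ((continuous_const.mul (Real.continuous_rpow_const hα.le)).pow i).div_const _
      have hi : ∀ i : ℕ, IntegrableOn (fun s : ℝ => (t - s) ^ (α - 1) •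
          ((b * s ^ α) ^ i / Real.Gamma ((i : ℝ) * α + 1))) (Ioc 0 t) := fun i =>
        kernel_integrable α t hα ht.1 _ (hc i).continuousOn
      have hui : IntegrableOn (fun s : ℝ => (t - s) ^ (α - 1) • u s) (Ioc 0 t) :=
        kernel_integrable α t hα ht.1 _ (hu.mono (Icc_subset_Icc_right ht.2))
      have hsum : IntegrableOn (fun s : ℝ => ∑ i ∈ Finset.range n, (t - s) ^ (α - 1) •
          ((b * s ^ α) ^ i / Real.Gamma ((i : ℝ) * α + 1))) (Ioc 0 t) :=
        integrable_finsetSum _ fun i _ => hi i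
      have hle : ∫ s in Ioc (0 : ℝ) t, (t - s) ^ (α - 1) • u s ≤
          ∫ s in Ioc (0 : ℝ) t, (d * (∑ i ∈ Finset.range n, (t - s) ^ (α - 1) •
          ((b * s ^ α) ^ i / Real.Gamma ((i : ℝ) * α + 1))) + M * ((t - s) ^ (α - 1) •
          ((b * s ^ α) ^ n / Real.Gamma ((n : ℝ) * α + 1)))) := by
        refine setIntegral_mono_on hui ((hsum.const_mul d).add ((hi n).const_mul M))
          measurableSet_Ioc fun s hs => ?_
        have h1 := ih s ⟨hs.1.le, hs.2.trans ht.2⟩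
        have h2 : 0 ≤ (t - s) ^ (α - 1) := Real.rpow_nonneg (by linarith [hs.2]) _
        have h3 := mul_le_mul_of_nonneg_left h1 h2
        simp only [smul_eq_mul, ← Finset.mul_sum]
        linarith
      rw [integral_add (hsum.const_mul d) ((hi n).const_mul M), integral_const_mul,
        integral_const_mul, integral_finsetSum _ fun i _ => hi i] at hle
      have h4 := mul_le_mul_of_nonneg_left hle (div_nonneg hb hG.le)
      have h5 := h t ht
      rw [Finset.sum_range_succ', ← ml_step α b t hα ht.1 n]
      simp_rw [← ml_step α b t hα ht.1]
      rw [← Finset.mul_sum]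
      simp only [pow_zero, Nat.cast_zero, zero_mul, zero_add, Real.Gamma_one, div_one]
      linarith
  have hs := ml_summable α hα (b * t ^ α)
  have hlim := (hs.hasSum.tendsto_sum_nat.const_mul d).add (hs.tendsto_atTop_zero.const_mul M)
  rw [mul_zero, add_zero] at hlim
  exact ge_of_tendsto' hlim fun n => P n t ht

/-- Fractional Grönwall-type stability and uniqueness for the fractional
Ornstein–Uhlenbeck equation `Y(t) = y + A I^α(Y)(t) + X(t)`:
`‖Y(t) - Ỹ(t)‖ ≤ ‖y - ỹ‖ E_{α,1}(‖A‖ Γ(α) t^α)`, and uniqueness for equal initial data. -/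
theorem fractional_ou_uniqueness
    {H : Type*} [NormedAddCommGroup H] [InnerProductSpace ℝ H] [CompleteSpace H]
    [TopologicalSpace.SeparableSpace H]
    (T α : ℝ) (hT : 0 ≤ T) (hα : α ∈ Ioo (0 : ℝ) 1)
    (A : H →L[ℝ] H) (y yt : H) (X Y Yt : ℝ → H)
    (hX : ContinuousOn X (Icc 0 T))
    (hY : ContinuousOn Y (Icc 0 T)) (hYt : ContinuousOn Yt (Icc 0 T))
    (heq : ∀ t ∈ Icc (0 : ℝ) T, Y t = y + A (fracInt α Y t) + X t)
    (heqt : ∀ t ∈ Icc (0 : ℝ) T, Yt t = yt + A (fracInt α Yt t) + X t) :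
    (∀ t ∈ Icc (0 : ℝ) T,
      ‖Y t - Yt t‖ ≤
        ‖y - yt‖ * ∑' i : ℕ, (‖A‖ * Real.Gamma α * t ^ α) ^ i /
          Real.Gamma ((i : ℝ) * α + 1)) ∧
    (y = yt → ∀ t ∈ Icc (0 : ℝ) T, Y t = Yt t) := by
  obtain ⟨h0, h1⟩ := hα
  have hG := Real.Gamma_pos_of_pos h0
  have hG1 := one_le_Gamma α h0 h1
  have main : ∀ t ∈ Icc (0 : ℝ) T,
      ‖Y t - Yt t‖ ≤
        ‖y - yt‖ * ∑' i : ℕ, (‖A‖ * Real.Gamma α * t ^ α) ^ i /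
          Real.Gamma ((i : ℝ) * α + 1) := by
    have hu : ContinuousOn (fun t => ‖Y t - Yt t‖) (Icc 0 T) := (hY.sub hYt).norm
    obtain ⟨M, hM⟩ := isCompact_Icc.bddAbove_image hu
    refine frac_gronwall T α (‖A‖ * Real.Gamma α) ‖y - yt‖ M h0 (by positivity)
      (fun t => ‖Y t - Yt t‖) hu (fun t ht => hM ⟨t, ht, rfl⟩) ?_
    intro t ht
    have hsub : Icc 0 t ⊆ Icc 0 T := Icc_subset_Icc_right ht.2
    have i1 := kernel_integrable α t h0 ht.1 Y (hY.mono hsub)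
    have i2 := kernel_integrable α t h0 ht.1 Yt (hYt.mono hsub)
    have hI : 0 ≤ ∫ s in Ioc (0 : ℝ) t, (t - s) ^ (α - 1) • ‖Y s - Yt s‖ := by
      refine setIntegral_nonneg measurableSet_Ioc fun s hs => ?_
      exact mul_nonneg (Real.rpow_nonneg (by linarith [hs.2]) _) (norm_nonneg _)
    have hd : fracInt α Y t - fracInt α Yt t =
        (Real.Gamma α)⁻¹ • ∫ s in Ioc (0 : ℝ) t, (t - s) ^ (α - 1) • (Y s - Yt s) := by
      simp only [fracInt, if_neg h0.ne']
      rw [← smul_sub, ← integral_sub i1 i2]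
      simp only [smul_sub]
    have hn : ‖∫ s in Ioc (0 : ℝ) t, (t - s) ^ (α - 1) • (Y s - Yt s)‖ ≤
        ∫ s in Ioc (0 : ℝ) t, (t - s) ^ (α - 1) • ‖Y s - Yt s‖ := by
      refine (norm_integral_le_integral_norm _).trans_eq ?_
      refine setIntegral_congr_fun measurableSet_Ioc fun s hs => ?_
      simp only [norm_smul, smul_eq_mul, Real.norm_eq_abs]
      rw [abs_of_nonneg (Real.rpow_nonneg (by linarith [hs.2]) _)]
    have hfr : ‖fracInt α Y t - fracInt α Yt t‖ ≤
        ∫ s in Ioc (0 : ℝ) t, (t - s) ^ (α - 1) • ‖Y s - Yt s‖ := by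
      rw [hd, norm_smul, norm_inv, Real.norm_of_nonneg hG.le]
      exact (mul_le_of_le_one_left (norm_nonneg _) (inv_le_one_of_one_le₀ hG1)).trans hn
    have e : Y t - Yt t = (y - yt) + A (fracInt α Y t - fracInt α Yt t) := by
      rw [heq t ht, heqt t ht, map_sub]; abel
    rw [mul_div_assoc, div_self hG.ne', mul_one]
    simp only [e]
    refine (norm_add_le _ _).trans ?_
    gcongr
    exact (A.le_opNorm _).trans (mul_le_mul_of_nonneg_left hfr (norm_nonneg _))
  refine ⟨main, fun hy t ht => ?_⟩
  have h := main t ht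
  rw [hy, sub_self, norm_zero, zero_mul] at h
  exact sub_eq_zero.mp (norm_le_zero_iff.mp h)
end
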